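/- arXiv:math/0509267 — 3 statements merged into one kernel-verified Lean document; each statement's English description precedes it below -/
import Mathlib

section
/- For the curvature of the Mrugala metric G at any point m ∈ P: (i) the sectional curvature of the plane spanned by ∂_{p_i} and ∂_{x^i} equals 3/4, i.e. G(R(∂_{p_i}, ∂_{x^i})∂_{x^i}, ∂_{p_i}) = −3/4 while G(∂_{p_i},∂_{p_i})G(∂_{x^i},∂_{x^i}) − G(∂_{p_i},∂_{x^i})² = −1; (ii) for each of the pairs (A,B) = (∂_{x^0}, ∂_{p_i}), (∂_{x^0}, ∂_{x^i}), (∂_{p_i}, ∂_{p_j}), (∂_{x^i}, ∂_{x^j}), the curvature numerator vanishes: G(R(A,B)B, A) = 0. -/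
/-!
Statement 6: Sectional curvatures of coordinate planes for the Mrugala metric:
(i) `G(R(∂_{p_i}, ∂_{x^i})∂_{x^i}, ∂_{p_i}) = -3/4` while the denominator
`G(∂_{p_i},∂_{p_i})G(∂_{x^i},∂_{x^i}) - G(∂_{p_i},∂_{x^i})² = -1`
(so the sectional curvature is 3/4);
(ii) for the pairs `(∂_{x^0}, ∂_{p_i})`, `(∂_{x^0}, ∂_{x^i})`, `(∂_{p_i}, ∂_{p_j})`,
`(∂_{x^i}, ∂_{x^j})` the curvature numerator `G(R(A,B)B, A)` vanishes.
-/

abbrev Idx (n : ℕ) : Type := Unit ⊕ (Fin n ⊕ Fin n)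
abbrev Pt (n : ℕ) : Type := Idx n → ℝ

/-- The Mrugala metric `G = [[1, 0, pᵀ], [0, 0ₙ, Iₙ], [p, Iₙ, p pᵀ]]`. -/
def Gmat (n : ℕ) (m : Pt n) : Matrix (Idx n) (Idx n) ℝ :=
  Matrix.of fun a b =>
    match a, b with
    | Sum.inl _, Sum.inl _ => 1
    | Sum.inl _, Sum.inr (Sum.inl _) => 0
    | Sum.inl _, Sum.inr (Sum.inr j) => m (Sum.inr (Sum.inl j))
    | Sum.inr (Sum.inl _), Sum.inl _ => 0
    | Sum.inr (Sum.inl _), Sum.inr (Sum.inl _) => 0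
    | Sum.inr (Sum.inl i), Sum.inr (Sum.inr j) => if i = j then 1 else 0
    | Sum.inr (Sum.inr i), Sum.inl _ => m (Sum.inr (Sum.inl i))
    | Sum.inr (Sum.inr i), Sum.inr (Sum.inl j) => if i = j then 1 else 0
    | Sum.inr (Sum.inr i), Sum.inr (Sum.inr j) =>
        m (Sum.inr (Sum.inl i)) * m (Sum.inr (Sum.inl j))

/-- Partial derivative `∂_a f (m)` of a scalar function on `P`. -/
noncomputable def pd {n : ℕ} (f : Pt n → ℝ) (m : Pt n) (a : Idx n) : ℝ :=
  fderiv ℝ f m (Pi.single a 1)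

/-- Christoffel symbols of the Mrugala metric. -/
noncomputable def Christoffel (n : ℕ) (m : Pt n) (α β γ : Idx n) : ℝ :=
  (1 / 2) * ∑ s, (Gmat n m)⁻¹ α s *
    (pd (fun m' => Gmat n m' γ s) m β + pd (fun m' => Gmat n m' β s) m γ
      - pd (fun m' => Gmat n m' β γ) m s)

/-- Covariant derivative `(∇_Y Z)^α = Y^β ∂_β Z^α + Γ^α_{βγ} Y^β Z^γ`. -/
noncomputable def covDeriv (n : ℕ) (Y Z : Pt n → Pt n) (m : Pt n) : Pt n := fun α =>
  (∑ β, Y m β * pd (fun m' => Z m' α) m β)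
    + ∑ β, ∑ γ, Christoffel n m α β γ * Y m β * Z m γ

/-- Lie bracket of vector fields, `[X,Y] = (DY)X - (DX)Y`. -/
noncomputable def bkt (n : ℕ) (X Y : Pt n → Pt n) : Pt n → Pt n := fun m =>
  fderiv ℝ Y m (X m) - fderiv ℝ X m (Y m)

/-- Curvature transformation `R(X,Y)Z = ∇_X∇_Y Z - ∇_Y∇_X Z - ∇_{[X,Y]}Z`. -/
noncomputable def curvT (n : ℕ) (X Y Z : Pt n → Pt n) (m : Pt n) : Pt n :=
  covDeriv n X (covDeriv n Y Z) m - covDeriv n Y (covDeriv n X Z) m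
    - covDeriv n (bkt n X Y) Z m

/-- Scalar product of tangent vectors in the metric `G`. -/
noncomputable def Gin (n : ℕ) (m : Pt n) (u v : Pt n) : ℝ :=
  ∑ a, ∑ b, u a * Gmat n m a b * v b

/-- Constant coordinate vector field `∂_a`. -/
noncomputable def cst (n : ℕ) (a : Idx n) : Pt n → Pt n := fun _ => Pi.single a 1

def Ginv (n : ℕ) (m : Pt n) : Matrix (Idx n) (Idx n) ℝ :=
  Matrix.of fun a b =>
    match a, b with
    | Sum.inl _, Sum.inl _ => 1
    | Sum.inl _, Sum.inr (Sum.inl i) => - m (Sum.inr (Sum.inl i))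
    | Sum.inl _, Sum.inr (Sum.inr _) => 0
    | Sum.inr (Sum.inl i), Sum.inl _ => - m (Sum.inr (Sum.inl i))
    | Sum.inr (Sum.inl _), Sum.inr (Sum.inl _) => 0
    | Sum.inr (Sum.inl i), Sum.inr (Sum.inr j) => if i = j then 1 else 0
    | Sum.inr (Sum.inr _), Sum.inl _ => 0
    | Sum.inr (Sum.inr i), Sum.inr (Sum.inl j) => if i = j then 1 else 0
    | Sum.inr (Sum.inr _), Sum.inr (Sum.inr _) => 0

theorem Ginv_eq (n : ℕ) (m : Pt n) : (Gmat n m)⁻¹ = Ginv n m := by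
  apply Matrix.inv_eq_right_inv
  ext a b
  rcases a with a | a | a <;> rcases b with b | b | b <;>
    simp [Matrix.mul_apply, Gmat, Ginv, Matrix.one_apply]

/-- derivative of the metric: `∂_c G_{ab}` -/
noncomputable def dG (n : ℕ) (m : Pt n) (a b c : Idx n) : ℝ :=
    match a, b, c with
    | Sum.inl _, Sum.inr (Sum.inr j), Sum.inr (Sum.inl k) => if j = k then 1 else 0
    | Sum.inr (Sum.inr j), Sum.inl _, Sum.inr (Sum.inl k) => if j = k then 1 else 0
    | Sum.inr (Sum.inr i), Sum.inr (Sum.inr j), Sum.inr (Sum.inl k) =>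
       (if i = k then 1 else 0) * m (Sum.inr (Sum.inl j)) +
       m (Sum.inr (Sum.inl i)) * (if j = k then 1 else 0)
    | _, _, _ => 0

theorem pd_coord {n : ℕ} (m : Pt n) (a c : Idx n) :
    pd (fun m' : Pt n => m' a) m c = if a = c then 1 else 0 := by
  unfold pd
  rw [(hasFDerivAt_apply a m).fderiv]
  simp [Pi.single_apply]

theorem pd_const {n : ℕ} (m : Pt n) (r : ℝ) (c : Idx n) :
    pd (fun _ : Pt n => r) m c = 0 := by
  simp [pd]

theorem pd_add {n : ℕ} (f g : Pt n → ℝ) (m : Pt n) (c : Idx n)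
    (hf : DifferentiableAt ℝ f m) (hg : DifferentiableAt ℝ g m) :
    pd (fun x => f x + g x) m c = pd f m c + pd g m c := by
  unfold pd
  rw [fderiv_fun_add hf hg]; simp

theorem pd_mul {n : ℕ} (f g : Pt n → ℝ) (m : Pt n) (c : Idx n)
    (hf : DifferentiableAt ℝ f m) (hg : DifferentiableAt ℝ g m) :
    pd (fun x => f x * g x) m c = pd f m c * g m + f m * pd g m c := by
  unfold pd
  rw [fderiv_fun_mul hf hg]; simp; ring

theorem pd_smul {n : ℕ} (f : Pt n → ℝ) (r : ℝ) (m : Pt n) (c : Idx n)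
    (hf : DifferentiableAt ℝ f m) :
    pd (fun x => r * f x) m c = r * pd f m c := by
  rw [pd_mul _ _ _ _ (by fun_prop) hf, pd_const]; ring

theorem dcoord {n : ℕ} (a : Idx n) (m : Pt n) :
    DifferentiableAt ℝ (fun m' : Pt n => m' a) m := by fun_prop

theorem pd_G {n : ℕ} (m : Pt n) (a b c : Idx n) :
    pd (fun m' => Gmat n m' a b) m c = dG n m a b c := by
  rcases a with a | a | a <;> rcases b with b | b | b <;>
    simp only [Gmat, Matrix.of_apply, pd_const, pd_coord,
      pd_mul _ _ _ _ (dcoord _ _) (dcoord _ _)] <;>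
    rcases c with c | c | c <;> simp [dG]

/-- explicit Christoffel symbols -/
noncomputable def Gam (n : ℕ) (m : Pt n) (α β γ : Idx n) : ℝ :=
  match α, β, γ with
  | Sum.inl _, Sum.inl _, Sum.inr (Sum.inr j) => (1/2) * m (Sum.inr (Sum.inl j))
  | Sum.inl _, Sum.inr (Sum.inr j), Sum.inl _ => (1/2) * m (Sum.inr (Sum.inl j))
  | Sum.inl _, Sum.inr (Sum.inl k), Sum.inr (Sum.inr j) => if k = j then 1/2 else 0
  | Sum.inl _, Sum.inr (Sum.inr j), Sum.inr (Sum.inl k) => if k = j then 1/2 else 0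
  | Sum.inl _, Sum.inr (Sum.inr i), Sum.inr (Sum.inr j) =>
      m (Sum.inr (Sum.inl i)) * m (Sum.inr (Sum.inl j))
  | Sum.inr (Sum.inl l), Sum.inl _, Sum.inr (Sum.inl k) => if l = k then 1/2 else 0
  | Sum.inr (Sum.inl l), Sum.inr (Sum.inl k), Sum.inl _ => if l = k then 1/2 else 0
  | Sum.inr (Sum.inl l), Sum.inr (Sum.inl k), Sum.inr (Sum.inr j) =>
      (if l = k then 1/2 else 0) * m (Sum.inr (Sum.inl j))
  | Sum.inr (Sum.inl l), Sum.inr (Sum.inr j), Sum.inr (Sum.inl k) =>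
      (if l = k then 1/2 else 0) * m (Sum.inr (Sum.inl j))
  | Sum.inr (Sum.inr l), Sum.inl _, Sum.inr (Sum.inr k) => if l = k then -1/2 else 0
  | Sum.inr (Sum.inr l), Sum.inr (Sum.inr k), Sum.inl _ => if l = k then -1/2 else 0
  | Sum.inr (Sum.inr l), Sum.inr (Sum.inr i), Sum.inr (Sum.inr j) =>
      (if l = i then -1/2 else 0) * m (Sum.inr (Sum.inl j)) +
      (if l = j then -1/2 else 0) * m (Sum.inr (Sum.inl i))
  | _, _, _ => 0

theorem Chr_eq {n : ℕ} (m : Pt n) (α β γ : Idx n) :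
    Christoffel n m α β γ = Gam n m α β γ := by
  unfold Christoffel
  simp only [Ginv_eq, pd_G]
  rcases α with a | a | a <;> rcases β with b | b | b <;> rcases γ with c | c | c <;>
    simp [Ginv, dG, Gam, Finset.sum_add_distrib, mul_add, mul_sub] <;>
    (try split_ifs) <;> (try subst_vars) <;> (try simp_all) <;> (try ring)

theorem cov_cst {n : ℕ} (a b : Idx n) :
    covDeriv n (cst n a) (cst n b) = fun m α => Gam n m α a b := by
  funext m α
  simp [covDeriv, cst, pd_const, Chr_eq, Pi.single_apply]

theorem curv_cst {n : ℕ} (a b : Idx n) (m : Pt n) (α : Idx n) :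
    curvT n (cst n a) (cst n b) (cst n b) m α =
      pd (fun x => Gam n x α b b) m a + ∑ γ, Gam n m α a γ * Gam n m γ b b
      - (pd (fun x => Gam n x α a b) m b + ∑ γ, Gam n m α b γ * Gam n m γ a b) := by
  have hb : bkt n (cst n a) (cst n b) = fun _ => 0 := by
    funext x
    simp [bkt, show cst n a = fun _ => Pi.single a 1 from rfl,
      show cst n b = fun _ => Pi.single b 1 from rfl]
  simp only [curvT, hb, cov_cst]
  simp [covDeriv, cst, Chr_eq, Pi.single_apply]

theorem Gin_cst {n : ℕ} (m : Pt n) (u : Pt n) (a : Idx n) :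
    Gin n m u (cst n a m) = ∑ s, u s * Gmat n m s a := by
  simp [Gin, cst, Pi.single_apply]

theorem pd_lin {n : ℕ} (m : Pt n) (r s : ℝ) (a b c : Idx n) :
    pd (fun x : Pt n => r * x a + s * x b) m c =
      r * (if a = c then 1 else 0) + s * (if b = c then 1 else 0) := by
  rw [pd_add _ _ _ _ (by fun_prop) (by fun_prop), pd_smul _ _ _ _ (dcoord _ _),
    pd_smul _ _ _ _ (dcoord _ _), pd_coord, pd_coord]

theorem pd_Gam_zero {n : ℕ} (m : Pt n) (α β γ c : Idx n)
    (hc : ∀ k, c ≠ Sum.inr (Sum.inl k)) :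
    pd (fun x => Gam n x α β γ) m c = 0 := by
  have hc' : ∀ k, Sum.inr (Sum.inl k) ≠ c := fun k => (hc k).symm
  rcases α with a | a | a <;> rcases β with b | b | b <;> rcases γ with d | d | d <;>
    simp only [Gam, pd_const, pd_coord, pd_smul _ _ _ _ (dcoord _ _), pd_lin,
      pd_mul _ _ _ _ (dcoord _ _) (dcoord _ _), if_neg (hc' _)] <;> simp

theorem mrugala_sectional_curvature (n : ℕ) (hn : 1 ≤ n) (m : Pt n) (i j : Fin n) :
    (Gin n m
        (curvT n (cst n (Sum.inr (Sum.inl i))) (cst n (Sum.inr (Sum.inr i)))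
          (cst n (Sum.inr (Sum.inr i))) m)
        (cst n (Sum.inr (Sum.inl i)) m) = -(3 / 4 : ℝ) ∧
      Gin n m (cst n (Sum.inr (Sum.inl i)) m) (cst n (Sum.inr (Sum.inl i)) m) *
          Gin n m (cst n (Sum.inr (Sum.inr i)) m) (cst n (Sum.inr (Sum.inr i)) m) -
          (Gin n m (cst n (Sum.inr (Sum.inl i)) m) (cst n (Sum.inr (Sum.inr i)) m)) ^ 2
        = -1) ∧
    Gin n m
        (curvT n (cst n (Sum.inl ())) (cst n (Sum.inr (Sum.inl i)))
          (cst n (Sum.inr (Sum.inl i))) m)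
        (cst n (Sum.inl ()) m) = 0 ∧
    Gin n m
        (curvT n (cst n (Sum.inl ())) (cst n (Sum.inr (Sum.inr i)))
          (cst n (Sum.inr (Sum.inr i))) m)
        (cst n (Sum.inl ()) m) = 0 ∧
    Gin n m
        (curvT n (cst n (Sum.inr (Sum.inl i))) (cst n (Sum.inr (Sum.inl j)))
          (cst n (Sum.inr (Sum.inl j))) m)
        (cst n (Sum.inr (Sum.inl i)) m) = 0 ∧
    Gin n m
        (curvT n (cst n (Sum.inr (Sum.inr i))) (cst n (Sum.inr (Sum.inr j)))
          (cst n (Sum.inr (Sum.inr j))) m)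
        (cst n (Sum.inr (Sum.inr i)) m) = 0 := by
  have hx : ∀ α β γ k, pd (fun x => Gam n x α β γ) m (Sum.inr (Sum.inr k)) = 0 :=
    fun α β γ k => pd_Gam_zero m α β γ _ (by simp)
  have h0 : ∀ α β γ, pd (fun x => Gam n x α β γ) m (Sum.inl ()) = 0 :=
    fun α β γ => pd_Gam_zero m α β γ _ (by simp)
  refine ⟨⟨?_, ?_⟩, ?_, ?_, ?_, ?_⟩
  · simp [Gin_cst, curv_cst, Gmat, Gam, hx, pd_const, pd_lin]
    norm_num
  · simp only [Gin_cst]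
    simp [Gmat, cst, Pi.single_apply]
  · simp [Gin_cst, curv_cst, Gmat, Gam, pd_const]
  · simp only [Gin_cst, curv_cst, hx, h0]
    simp [Gmat, Gam, mul_add, add_mul, sub_mul, Finset.sum_add_distrib]
    ring
  · simp [Gin_cst, curv_cst, Gmat, Gam, pd_const]
  · simp only [Gin_cst, curv_cst, hx, h0]
    by_cases hij : i = j
    · subst hij
      simp
    · have hji : ¬ j = i := fun h => hij h.symm
      simp only [Fintype.sum_sum_type, Gmat, Gam, Matrix.of_apply, Finset.univ_unique,
        Finset.sum_singleton, zero_add, mul_zero, zero_mul, add_zero,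
        Finset.sum_const_zero, sub_zero, zero_sub, mul_ite, ite_mul, mul_one, one_mul,
        Finset.sum_ite_eq, Finset.sum_ite_eq', Finset.mem_univ, if_true, hij, hji, if_false]
      simp only [mul_add, add_mul, sub_mul, Finset.sum_add_distrib, Finset.sum_sub_distrib,
        neg_mul, Finset.sum_neg_distrib, mul_ite, ite_mul, mul_zero, zero_mul,
        Finset.sum_ite_eq, Finset.sum_ite_eq', Finset.mem_univ, if_true, hij, hji, if_false,
        Finset.sum_const_zero, add_zero, zero_add]
      ring
end

section
/- Let I, J be a partition of {1,…,n} and φ a smooth function of (p_i)_{i∈I}, (x^j)_{j∈J} whose Hessian blocks (φ_{ii'})_{i,i'∈I} and (φ_{jj'})_{j,j'∈J} are invertible on an open set; write φ_{kl} for the second partial derivatives of φ (with φ^{kl} the inverse matrices on the I- and J-blocks, and φ^{ij} = 0 for mixed indices). Define vector fields on P (with φ and its derivatives regarded as functions of the ambient coordinates (p_i)_{i∈I}, (x^j)_{j∈J}): V_k = ∂_{p_k} for k ∈ I and V_k = X_k = ∂_{x^k} − p_k∂_{x^0} for k ∈ J; W_k = X_k for k ∈ I and W_k = −∂_{p_k}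 for k ∈ J; Y_k = V_k + Σ_l φ_{kl} W_l; Z_k = W_k − ½ Σ_l φ^{kl} Y_l. Then: (a) ξ = ∂_{x^0} and each Z_k are G-orthogonal to every Y_l; (b) ∇_{Y_k} Y_l = Σ_s Y_k(φ_{ls}) W_s = ½ Σ_{s,r} φ^{sr} Y_k(φ_{ls}) Y_r + Σ_s Y_k(φ_{ls}) Z_s, so the second fundamental form of the Legendre submanifold Σ_φ is II(Y_k, Y_l) = Σ_s φ_{lks} Z_s with φ_{lks} = Y_k(φ_{ls}). -/
/-- Projection of a point of `P` onto the parameters `(p_i)_{i∈I}, (x^j)_{j∉I}`. -/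
def projPar {n : ℕ} (I : Finset (Fin n)) (m : Pt n) : Fin n → ℝ := fun k =>
  if k ∈ I then m (Sum.inr (Sum.inl k)) else m (Sum.inr (Sum.inr k))

/-- First partial derivatives of `φ` on the parameter space. -/
noncomputable def pd1 {n : ℕ} (φ : (Fin n → ℝ) → ℝ) (q : Fin n → ℝ) (i : Fin n) : ℝ :=
  fderiv ℝ φ q (Pi.single i 1)

/-- Second partial derivatives `φ_{kl}` of `φ` on the parameter space. -/
noncomputable def pd2 {n : ℕ} (φ : (Fin n → ℝ) → ℝ) (q : Fin n → ℝ) (i j : Fin n) : ℝ :=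
  fderiv ℝ (fun q' => pd1 φ q' j) q (Pi.single i 1)

/-- `X_k = ∂_{x^k} - p_k ∂_{x^0}`. -/
noncomputable def Xvec {n : ℕ} (m : Pt n) (k : Fin n) : Pt n :=
  (Pi.single (Sum.inr (Sum.inr k)) 1 : Pt n) -
    m (Sum.inr (Sum.inl k)) • (Pi.single (Sum.inl ()) 1 : Pt n)

/-- `V_k`: equals `∂_{p_k}` for `k ∈ I` and `X_k` for `k ∉ I`. -/
noncomputable def Vfld {n : ℕ} (I : Finset (Fin n)) (k : Fin n) : Pt n → Pt n := fun m =>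
  if k ∈ I then (Pi.single (Sum.inr (Sum.inl k)) 1 : Pt n) else Xvec m k

/-- `W_k`: equals `X_k` for `k ∈ I` and `-∂_{p_k}` for `k ∉ I`. -/
noncomputable def Wfld {n : ℕ} (I : Finset (Fin n)) (k : Fin n) : Pt n → Pt n := fun m =>
  if k ∈ I then Xvec m k else -(Pi.single (Sum.inr (Sum.inl k)) 1 : Pt n)

/-- `Y_k = V_k + Σ_l φ_{kl} W_l` (with `φ_{kl}` regarded as a function
of the ambient coordinates via `projPar`). -/
noncomputable def Yfld {n : ℕ} (I : Finset (Fin n)) (φ : (Fin n → ℝ) → ℝ)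
    (k : Fin n) : Pt n → Pt n := fun m =>
  Vfld I k m + ∑ l, pd2 φ (projPar I m) k l • Wfld I l m

/-- `Z_k = W_k - ½ Σ_l φ^{kl} Y_l`. -/
noncomputable def Zfld {n : ℕ} (I : Finset (Fin n)) (φ : (Fin n → ℝ) → ℝ)
    (ψ : (Fin n → ℝ) → Fin n → Fin n → ℝ) (k : Fin n) : Pt n → Pt n := fun m =>
  Wfld I k m - (1 / 2 : ℝ) • ∑ l, ψ (projPar I m) k l • Yfld I φ l m

/-- `φ_{lks} = Y_k(φ_{ls})`, the derivative of `φ_{ls}` along `Y_k`. -/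
noncomputable def phid {n : ℕ} (I : Finset (Fin n)) (φ : (Fin n → ℝ) → ℝ)
    (k l s : Fin n) (m : Pt n) : ℝ :=
  fderiv ℝ (fun m' => pd2 φ (projPar I m') l s) m (Yfld I φ k m)

section helpers
variable {n : ℕ}

lemma aux_pd2_eq (φ : (Fin n → ℝ) → ℝ) (hφ : ContDiff ℝ (⊤ : ℕ∞) φ) (q : Fin n → ℝ) (i j : Fin n) :
    pd2 φ q i j = fderiv ℝ (fderiv ℝ φ) q (Pi.single i 1) (Pi.single j 1) := by
  have h1 : ContDiff ℝ 1 (fderiv ℝ φ) := hφ.fderiv_right (by norm_cast)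
  have h2 : DifferentiableAt ℝ (fderiv ℝ φ) q := (h1.differentiable one_ne_zero) q
  unfold pd2 pd1
  rw [fderiv_clm_apply h2 (differentiableAt_const _)]
  simp

lemma aux_pd2_symm (φ : (Fin n → ℝ) → ℝ) (hφ : ContDiff ℝ (⊤ : ℕ∞) φ) (q : Fin n → ℝ) (i j : Fin n) :
    pd2 φ q i j = pd2 φ q j i := by
  rw [aux_pd2_eq φ hφ, aux_pd2_eq φ hφ]
  have h : IsSymmSndFDerivAt ℝ φ q :=
    (hφ.contDiffAt).isSymmSndFDerivAt (by simp; norm_cast)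
  exact h _ _

lemma aux_diff (I : Finset (Fin n)) (φ : (Fin n → ℝ) → ℝ) (hφ : ContDiff ℝ (⊤ : ℕ∞) φ) (i j : Fin n) :
    Differentiable ℝ (fun m : Pt n => pd2 φ (projPar I m) i j) := by
  have h0 : ContDiff ℝ 2 (fderiv ℝ φ) := hφ.fderiv_right (by norm_cast)
  have h1 : ContDiff ℝ 2 (fun q => pd1 φ q j) := h0.clm_apply contDiff_const
  have h1' : ContDiff ℝ 1 (fderiv ℝ (fun q => pd1 φ q j)) := h1.fderiv_right (by norm_num)
  have h2 : ContDiff ℝ 1 (fun q => pd2 φ q i j) := h1'.clm_apply contDiff_const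
  have h3 : Differentiable ℝ (fun m : Pt n => projPar I m) := by
    rw [differentiable_pi]
    intro k
    unfold projPar
    split_ifs <;> fun_prop
  exact (h2.differentiable one_ne_zero).comp h3

lemma aux_sum_pd (f : Pt n → ℝ) (m v : Pt n) : ∑ b, v b * pd f m b = fderiv ℝ f m v := by
  conv_rhs => rw [pi_eq_sum_univ' v, map_sum]
  refine Finset.sum_congr rfl fun b _ => ?_
  rw [map_smul, smul_eq_mul, pd]

lemma aux_Y0 (I : Finset (Fin n)) (φ) (l : Fin n) (m : Pt n) :
    Yfld I φ l m (Sum.inl ()) = - ∑ i, m (Sum.inr (Sum.inl i)) *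
      (if i ∈ I then pd2 φ (projPar I m) l i else if l = i then 1 else 0) := by
  have : ∀ i, (pd2 φ (projPar I m) l i • Wfld I i m) (Sum.inl ()) = 
     - (m (Sum.inr (Sum.inl i)) * (if i ∈ I then pd2 φ (projPar I m) l i else 0)) := by
    intro i
    unfold Wfld Xvec
    split_ifs <;> simp [mul_comm]
  have h2 : Vfld I l m (Sum.inl ()) = - ∑ i, m (Sum.inr (Sum.inl i)) *
      (if i ∈ I then 0 else if l = i then 1 else 0) := by
    rw [Finset.sum_eq_single l]
    · unfold Vfld Xvec
      by_cases h : l ∈ I <;> simp [h]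
    · intro b _ hb
      simp [hb.symm]
    · simp
  unfold Yfld
  rw [Pi.add_apply, Finset.sum_apply, Finset.sum_congr rfl (fun i _ => this i), h2,
    Finset.sum_neg_distrib, ← neg_add, ← Finset.sum_add_distrib]
  congr 1
  refine Finset.sum_congr rfl fun i _ => ?_
  split_ifs <;> simp

lemma aux_Yp (I : Finset (Fin n)) (φ) (l i : Fin n) (m : Pt n) :
    Yfld I φ l m (Sum.inr (Sum.inl i)) =
      (if i ∈ I then (if l = i then 1 else 0) else - pd2 φ (projPar I m) l i) := by
  unfold Yfld
  rw [Pi.add_apply, Finset.sum_apply, Finset.sum_eq_single i]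
  · unfold Vfld Wfld Xvec
    by_cases h : l = i
    · subst h; by_cases h : l ∈ I <;> simp [h]
    · split_ifs <;> simp [h, Pi.single_apply, Ne.symm h]
  · intro b _ hb
    unfold Wfld Xvec
    split_ifs <;> simp [hb.symm, Pi.single_apply]
  · simp

lemma aux_Yx (I : Finset (Fin n)) (φ) (l i : Fin n) (m : Pt n) :
    Yfld I φ l m (Sum.inr (Sum.inr i)) =
      (if i ∈ I then pd2 φ (projPar I m) l i else if l = i then 1 else 0) := by
  unfold Yfld
  rw [Pi.add_apply, Finset.sum_apply, Finset.sum_eq_single i]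
  · unfold Vfld Wfld Xvec
    by_cases h : l = i
    · subst h; by_cases h : l ∈ I <;> simp [h]
    · split_ifs <;> simp [h, Pi.single_apply, Ne.symm h]
  · intro b _ hb
    unfold Wfld Xvec
    split_ifs <;> simp [hb.symm, Pi.single_apply]
  · simp

lemma aux_Gin (m u v : Pt n) : Gin n m u v =
    (u (Sum.inl ()) + ∑ i, m (Sum.inr (Sum.inl i)) * u (Sum.inr (Sum.inr i))) *
    (v (Sum.inl ()) + ∑ i, m (Sum.inr (Sum.inl i)) * v (Sum.inr (Sum.inr i))) +
    ∑ i, (u (Sum.inr (Sum.inl i)) * v (Sum.inr (Sum.inr i)) +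
      u (Sum.inr (Sum.inr i)) * v (Sum.inr (Sum.inl i))) := by
  simp only [Gin, Gmat, Matrix.of_apply, Fintype.sum_sum_type, Finset.univ_unique, Finset.sum_singleton,
    mul_one, mul_zero, zero_mul, Finset.sum_const_zero, mul_ite, ite_mul, Finset.sum_ite_eq,
    Finset.mem_univ, if_true, zero_add, add_zero, Finset.sum_add_distrib, PUnit.default_eq_unit]
  rw [add_mul, mul_add, mul_add, Finset.sum_mul_sum, Finset.mul_sum, Finset.sum_mul]
  have e1 : ∑ x, u (Sum.inl ()) * m (Sum.inr (Sum.inl x)) * v (Sum.inr (Sum.inr x)) =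
    ∑ x, u (Sum.inl ()) * (m (Sum.inr (Sum.inl x)) * v (Sum.inr (Sum.inr x))) := by
    simp only [mul_assoc]
  have e2 : ∑ x, u (Sum.inr (Sum.inr x)) * m (Sum.inr (Sum.inl x)) * v (Sum.inl ()) =
    ∑ x, m (Sum.inr (Sum.inl x)) * u (Sum.inr (Sum.inr x)) * v (Sum.inl ()) := by
    refine Finset.sum_congr rfl fun i _ => by ring
  have e3 : ∑ x, ∑ y, u (Sum.inr (Sum.inr x)) * (m (Sum.inr (Sum.inl x)) * m (Sum.inr (Sum.inl y))) * v (Sum.inr (Sum.inr y)) =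
    ∑ x, ∑ y, m (Sum.inr (Sum.inl x)) * u (Sum.inr (Sum.inr x)) * (m (Sum.inr (Sum.inl y)) * v (Sum.inr (Sum.inr y))) := by
    refine Finset.sum_congr rfl fun i _ => Finset.sum_congr rfl fun j _ => by ring
  rw [e1, e2, e3]
  ring

lemma aux_Gin_dot (m u v : Pt n) : Gin n m u v = u ⬝ᵥ (Matrix.mulVec (Gmat n m) v) := by
  simp only [Gin, dotProduct, Matrix.mulVec, Finset.mul_sum, mul_assoc]

lemma aux_unit (m : Pt n) : IsUnit (Gmat n m) := by
  rw [← Matrix.mulVec_injective_iff_isUnit]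
  rw [← Matrix.coe_mulVecLin, ← LinearMap.ker_eq_bot, LinearMap.ker_eq_bot']
  intro v hv
  have hG : ∀ u, Gin n m u v = 0 := by
    intro u
    rw [aux_Gin_dot, ← Matrix.mulVecLin_apply, hv, dotProduct_zero]
  have h0 := hG (Pi.single (Sum.inl ()) 1)
  have hp : ∀ i, v (Sum.inr (Sum.inr i)) = 0 := fun i => by
    simpa [aux_Gin, Pi.single_apply] using hG (Pi.single (Sum.inr (Sum.inl i)) 1)
  have h0' : v (Sum.inl ()) = 0 := by
    simpa [aux_Gin, Pi.single_apply, hp] using h0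
  have hx : ∀ i, v (Sum.inr (Sum.inl i)) = 0 := fun i => by
    simpa [aux_Gin, Pi.single_apply, hp, h0'] using hG (Pi.single (Sum.inr (Sum.inr i)) 1)
  funext a
  rcases a with a | a | a
  · exact h0'
  · exact hx a
  · exact hp a

lemma aux_pd_coord (m : Pt n) (a b : Idx n) : pd (fun m' : Pt n => m' a) m b = if a = b then 1 else 0 := by
  unfold pd
  have : HasFDerivAt (fun m' : Pt n => m' a) (ContinuousLinearMap.proj (R := ℝ) a) m := hasFDerivAt_apply a m
  rw [this.fderiv]
  simp [Pi.single_apply]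

lemma aux_pd_mul (m : Pt n) (a c b : Idx n) : pd (fun m' : Pt n => m' a * m' c) m b =
    (if a = b then 1 else 0) * m c + m a * if c = b then 1 else 0 := by
  rw [← aux_pd_coord m a b, ← aux_pd_coord m c b]
  unfold pd
  rw [fderiv_fun_mul (by fun_prop) (by fun_prop)]
  simp
  ring

lemma aux_pd_const (m : Pt n) (c : ℝ) (b : Idx n) : pd (fun _ : Pt n => c) m b = 0 := by
  simp [pd]

/-- derivative of Gin along w, for fixed u v -/
lemma aux_DG (m u v w : Pt n) : ∑ a, ∑ b, ∑ s, pd (fun m' => Gmat n m' a b) m s * u a * v b * w s =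
    (∑ i, w (Sum.inr (Sum.inl i)) * u (Sum.inr (Sum.inr i))) *
    (v (Sum.inl ()) + ∑ i, m (Sum.inr (Sum.inl i)) * v (Sum.inr (Sum.inr i))) +
    (u (Sum.inl ()) + ∑ i, m (Sum.inr (Sum.inl i)) * u (Sum.inr (Sum.inr i))) *
    (∑ i, w (Sum.inr (Sum.inl i)) * v (Sum.inr (Sum.inr i))) := by
  have hd : ∀ a b, DifferentiableAt ℝ (fun m' => Gmat n m' a b) m := by
    intro a b
    rcases a with a | a | a <;> rcases b with b | b | b <;> simp only [Gmat, Matrix.of_apply] <;> fun_prop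
  have h1 : ∑ a, ∑ b, ∑ s, pd (fun m' => Gmat n m' a b) m s * u a * v b * w s =
      fderiv ℝ (fun m' => Gin n m' u v) m w := by
    unfold Gin
    rw [fderiv_fun_sum (fun a _ => by fun_prop), ContinuousLinearMap.sum_apply]
    refine Finset.sum_congr rfl fun a _ => ?_
    rw [fderiv_fun_sum (fun b _ => by fun_prop), ContinuousLinearMap.sum_apply]
    refine Finset.sum_congr rfl fun b _ => ?_
    rw [fderiv_mul_const (by fun_prop), fderiv_const_mul (by fun_prop)]
    simp only [ContinuousLinearMap.smul_apply, smul_eq_mul]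
    rw [← aux_sum_pd, Finset.mul_sum, Finset.mul_sum]
    refine Finset.sum_congr rfl fun s _ => by ring
  have hl : ∀ u : Pt n, HasFDerivAt (fun m' : Pt n => u (Sum.inl ()) + ∑ i, m' (Sum.inr (Sum.inl i)) * u (Sum.inr (Sum.inr i)))
      (∑ i, u (Sum.inr (Sum.inr i)) • (ContinuousLinearMap.proj (R := ℝ) (φ := fun _ : Idx n => ℝ) (Sum.inr (Sum.inl i)))) m := by
    intro u
    refine HasFDerivAt.const_add _ ?_
    refine HasFDerivAt.fun_sum fun i _ => ?_
    exact (hasFDerivAt_apply (𝕜 := ℝ) (F' := fun _ : Idx n => ℝ) (Sum.inr (Sum.inl i)) m).mul_const _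
  rw [h1]
  simp only [aux_Gin]
  rw [(((hl u).fun_mul (hl v)).add_const _).fderiv]
  simp [ContinuousLinearMap.sum_apply, mul_comm]
  ring

lemma aux_Gsymm (m : Pt n) (a b : Idx n) : Gmat n m a b = Gmat n m b a := by
  rcases a with a | a | a <;> rcases b with b | b | b <;> simp [Gmat, eq_comm, mul_comm]

lemma aux_chr (m A B : Pt n)
    (hA : A (Sum.inl ()) + ∑ i, m (Sum.inr (Sum.inl i)) * A (Sum.inr (Sum.inr i)) = 0)
    (hB : B (Sum.inl ()) + ∑ i, m (Sum.inr (Sum.inl i)) * B (Sum.inr (Sum.inr i)) = 0) (α : Idx n) :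
    ∑ β, ∑ γ, Christoffel n m α β γ * A β * B γ =
     (1/2) * (∑ i, A (Sum.inr (Sum.inl i)) * B (Sum.inr (Sum.inr i)) +
      ∑ i, B (Sum.inr (Sum.inl i)) * A (Sum.inr (Sum.inr i))) * (Pi.single (Sum.inl ()) 1 : Pt n) α := by
  set κ := (∑ i, A (Sum.inr (Sum.inl i)) * B (Sum.inr (Sum.inr i)) +
      ∑ i, B (Sum.inr (Sum.inl i)) * A (Sum.inr (Sum.inr i))) with hκ
  have hK : ∀ w : Pt n, ∑ s, (∑ β, ∑ γ, (pd (fun m' => Gmat n m' γ s) m β + pd (fun m' => Gmat n m' β s) m γ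
      - pd (fun m' => Gmat n m' β γ) m s) * A β * B γ) * w s = κ * Gin n m w (Pi.single (Sum.inl ()) 1) := by
    intro w
    have e : ∑ s, (∑ β, ∑ γ, (pd (fun m' => Gmat n m' γ s) m β + pd (fun m' => Gmat n m' β s) m γ
      - pd (fun m' => Gmat n m' β γ) m s) * A β * B γ) * w s =
       ∑ a, ∑ b, ∑ s, pd (fun m' => Gmat n m' a b) m s * B a * w b * A s +
       ∑ a, ∑ b, ∑ s, pd (fun m' => Gmat n m' a b) m s * A a * w b * B s -
       ∑ a, ∑ b, ∑ s, pd (fun m' => Gmat n m' a b) m s * A a * B b * w s := by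
      simp only [add_mul, sub_mul, Finset.sum_add_distrib, Finset.sum_sub_distrib, Finset.sum_mul]
      congr 1
      · congr 1
        · rw [Finset.sum_comm]
          simp_rw [Finset.sum_comm (s := (Finset.univ : Finset (Idx n))) (f := fun (x : Idx n) y => pd (fun m' => Gmat n m' y x) m _ * _ * _ * _)]
          rw [Finset.sum_comm]
          refine Finset.sum_congr rfl fun a _ => ?_
          rw [Finset.sum_comm]
          refine Finset.sum_congr rfl fun b _ => ?_
          refine Finset.sum_congr rfl fun s _ => by ring
        · rw [Finset.sum_comm]
          refine Finset.sum_congr rfl fun a _ => ?_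
          refine Finset.sum_congr rfl fun b _ => ?_
          refine Finset.sum_congr rfl fun s _ => by ring
      · rw [Finset.sum_comm]
        refine Finset.sum_congr rfl fun a _ => ?_
        rw [Finset.sum_comm]
    rw [e, aux_DG, aux_DG, aux_DG, hA, hB, aux_Gin, hκ]
    simp [Pi.single_apply]
    ring
  have hK' : (fun s => ∑ β, ∑ γ, (pd (fun m' => Gmat n m' γ s) m β + pd (fun m' => Gmat n m' β s) m γ
      - pd (fun m' => Gmat n m' β γ) m s) * A β * B γ) =
      Matrix.mulVec (Gmat n m) (κ • (Pi.single (Sum.inl ()) 1 : Pt n)) := by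
    refine dotProduct_eq _ _ fun w => ?_
    rw [Matrix.mulVec_smul, smul_dotProduct, dotProduct_comm (Matrix.mulVec _ _), ← aux_Gin_dot, smul_eq_mul, ← hK w]
    rfl
  have hdet : IsUnit (Gmat n m).det := (Matrix.isUnit_iff_isUnit_det _).1 (aux_unit m)
  have h3 := congrArg (fun v => Matrix.mulVec (Gmat n m)⁻¹ v α) hK'
  simp only [Matrix.mulVec_mulVec, Matrix.nonsing_inv_mul _ hdet, Matrix.one_mulVec, Pi.smul_apply, smul_eq_mul] at h3
  rw [mul_assoc, ← h3]
  simp only [Christoffel, Matrix.mulVec, dotProduct, Finset.mul_sum, Finset.sum_mul]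
  symm
  rw [Finset.sum_comm]
  refine Finset.sum_congr rfl fun a _ => ?_
  rw [Finset.sum_comm]
  refine Finset.sum_congr rfl fun b _ => ?_
  refine Finset.sum_congr rfl fun s _ => by ring

lemma aux_theta (I : Finset (Fin n)) (φ) (l : Fin n) (m : Pt n) :
    Yfld I φ l m (Sum.inl ()) + ∑ i, m (Sum.inr (Sum.inl i)) * Yfld I φ l m (Sum.inr (Sum.inr i)) = 0 := by
  simp only [aux_Y0, aux_Yx]
  ring

lemma aux_GYY (I : Finset (Fin n)) (φ) (hφ : ContDiff ℝ (⊤ : ℕ∞) φ) (k l : Fin n) (m : Pt n) :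
    Gin n m (Yfld I φ k m) (Yfld I φ l m) =
     ((if k ∈ I then 1 else -1) + (if l ∈ I then 1 else -1)) * pd2 φ (projPar I m) k l := by
  rw [aux_Gin, aux_theta, aux_theta]
  simp only [aux_Yp, aux_Yx]
  have : ∀ i, ((if i ∈ I then if k = i then (1:ℝ) else 0 else -pd2 φ (projPar I m) k i) *
        (if i ∈ I then pd2 φ (projPar I m) l i else if l = i then 1 else 0) +
      (if i ∈ I then pd2 φ (projPar I m) k i else if k = i then 1 else 0) *
        if i ∈ I then if l = i then 1 else 0 else -pd2 φ (projPar I m) l i) =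
      (if k = i then (if i ∈ I then 1 else -1) * pd2 φ (projPar I m) l i else 0) +
      (if l = i then (if i ∈ I then 1 else -1) * pd2 φ (projPar I m) k i else 0) := by
    intro i
    split_ifs <;> ring
  simp only [this, Finset.sum_add_distrib, Finset.sum_ite_eq, Finset.mem_univ, if_true]
  rw [aux_pd2_symm φ hφ _ l k]
  ring

lemma aux_W0 (I : Finset (Fin n)) (s : Fin n) (m : Pt n) :
    Wfld I s m (Sum.inl ()) = if s ∈ I then - m (Sum.inr (Sum.inl s)) else 0 := by
  unfold Wfld Xvec
  split_ifs <;> simp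

lemma aux_Wp (I : Finset (Fin n)) (s i : Fin n) (m : Pt n) :
    Wfld I s m (Sum.inr (Sum.inl i)) = if i = s then (if i ∈ I then 0 else -1) else 0 := by
  unfold Wfld Xvec
  by_cases h : i = s
  · subst h; by_cases h : i ∈ I <;> simp [h]
  · split_ifs <;> simp [h, Pi.single_apply]

lemma aux_Wx (I : Finset (Fin n)) (s i : Fin n) (m : Pt n) :
    Wfld I s m (Sum.inr (Sum.inr i)) = if i = s then (if i ∈ I then 1 else 0) else 0 := by
  unfold Wfld Xvec
  by_cases h : i = s
  · subst h; by_cases h : i ∈ I <;> simp [h]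
  · split_ifs <;> simp [h, Pi.single_apply]

lemma aux_GWY (I : Finset (Fin n)) (φ) (k l : Fin n) (m : Pt n) :
    Gin n m (Wfld I k m) (Yfld I φ l m) = if k = l then (if k ∈ I then 1 else -1) else 0 := by
  rw [aux_Gin, aux_theta, mul_zero, zero_add, Finset.sum_eq_single k]
  · rw [aux_Yp, aux_Yx, aux_Wp, aux_Wx]
    by_cases h : k = l
    · subst h; split_ifs <;> simp
    · split_ifs <;> simp_all
  · intro b _ hb
    simp [aux_Wp, aux_Wx, hb]
  · simp

lemma aux_cov (I : Finset (Fin n)) (φ : (Fin n → ℝ) → ℝ) (hφ : ContDiff ℝ (⊤ : ℕ∞) φ) (k l : Fin n) (m : Pt n) :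
    covDeriv n (Yfld I φ k) (Yfld I φ l) m = ∑ s, phid I φ k l s m • Wfld I s m := by
  have hD := fun i => aux_diff I φ hφ l i
  have hDc : ∀ i, Differentiable ℝ (fun m : Pt n => if i ∈ I then pd2 φ (projPar I m) l i else if l = i then 1 else 0) := by
    intro i
    by_cases h : i ∈ I
    · simpa [h] using hD i
    · simp [h]
  have hF : ∀ i, fderiv ℝ (fun m : Pt n => if i ∈ I then pd2 φ (projPar I m) l i else if l = i then 1 else 0) m (Yfld I φ k m)
      = if i ∈ I then phid I φ k l i m else 0 := by
    intro i
    by_cases h : i ∈ I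
    · simp [h, phid]
    · simp [h]
  funext α
  unfold covDeriv
  rw [aux_chr m _ _ (aux_theta I φ k m) (aux_theta I φ l m), aux_sum_pd, Finset.sum_apply]
  rcases α with α | α | α
  · obtain rfl : α = () := rfl
    simp only [Pi.smul_apply, smul_eq_mul, Pi.single_eq_same, mul_one, aux_W0]
    simp only [aux_Y0]
    have hsum : HasFDerivAt (fun m : Pt n => -∑ i, m (Sum.inr (Sum.inl i)) *
        (if i ∈ I then pd2 φ (projPar I m) l i else if l = i then 1 else 0)) _ m :=
      (HasFDerivAt.fun_sum (u := Finset.univ) fun i _ =>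
       (hasFDerivAt_apply (𝕜 := ℝ) (F' := fun _ : Idx n => ℝ) (Sum.inr (Sum.inl i)) m).fun_mul (hDc i m).hasFDerivAt).fun_neg
    rw [hsum.fderiv]
    simp only [ContinuousLinearMap.neg_apply, ContinuousLinearMap.sum_apply, ContinuousLinearMap.add_apply,
      ContinuousLinearMap.smul_apply, ContinuousLinearMap.proj_apply, smul_eq_mul, hF, aux_Yp, aux_Yx]
    have hs := aux_pd2_symm φ hφ (projPar I m) k l
    have e1 : ∀ k l, ∑ i, (if i ∈ I then if k = i then (1:ℝ) else 0 else -pd2 φ (projPar I m) k i) *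
        (if i ∈ I then pd2 φ (projPar I m) l i else if l = i then 1 else 0) =
        (if k ∈ I then pd2 φ (projPar I m) l k else 0) - (if l ∈ I then 0 else pd2 φ (projPar I m) k l) := by
      intro k l
      have : ∀ i, (if i ∈ I then if k = i then (1:ℝ) else 0 else -pd2 φ (projPar I m) k i) *
        (if i ∈ I then pd2 φ (projPar I m) l i else if l = i then 1 else 0) =
        (if k = i then (if i ∈ I then pd2 φ (projPar I m) l i else 0) else 0) -
        (if l = i then (if i ∈ I then 0 else pd2 φ (projPar I m) k i) else 0) := by
        intro i
        split_ifs <;> ring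
      simp only [this, Finset.sum_sub_distrib, Finset.sum_ite_eq, Finset.mem_univ, if_true]
    have e2 : ∑ i, (if i ∈ I then pd2 φ (projPar I m) l i else if l = i then 1 else 0) *
        (if i ∈ I then if k = i then (1:ℝ) else 0 else -pd2 φ (projPar I m) k i) =
        (if k ∈ I then pd2 φ (projPar I m) l k else 0) - (if l ∈ I then 0 else pd2 φ (projPar I m) k l) := by
      rw [← e1]
      exact Finset.sum_congr rfl fun i _ => mul_comm _ _
    rw [Finset.sum_add_distrib, e2, e1, e1, hs]
    have e3 : ∑ x, phid I φ k l x m * (if x ∈ I then -m (Sum.inr (Sum.inl x)) else 0) =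
      - ∑ x, m (Sum.inr (Sum.inl x)) * (if x ∈ I then phid I φ k l x m else 0) := by
      rw [← Finset.sum_neg_distrib]
      refine Finset.sum_congr rfl fun i _ => ?_
      split_ifs <;> ring
    rw [e3]
    split_ifs <;> ring
  · simp only [Pi.smul_apply, smul_eq_mul, aux_Wp, aux_Yp]
    by_cases h : α ∈ I
    · simp [h]
    · simp [h, phid]
  · simp only [Pi.smul_apply, smul_eq_mul, aux_Wx]
    simp only [aux_Yx, hF]
    simp

end helpers

theorem legendre_second_fundamental_form (n : ℕ) (hn : 1 ≤ n)
    (I : Finset (Fin n)) (φ : (Fin n → ℝ) → ℝ) (hφ : ContDiff ℝ (⊤ : ℕ∞) φ)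
    (ψ : (Fin n → ℝ) → Fin n → Fin n → ℝ) (U : Set (Fin n → ℝ)) (hU : IsOpen U)
    -- `ψ` vanishes on mixed indices
    (hmix : ∀ q ∈ U, ∀ k l : Fin n,
      ((k ∈ I ∧ l ∉ I) ∨ (k ∉ I ∧ l ∈ I)) → ψ q k l = 0)
    -- `ψ` is the inverse of the Hessian on the `I`-block
    (hinvI : ∀ q ∈ U, ∀ k ∈ I, ∀ l ∈ I,
      (∑ r ∈ I, pd2 φ q k r * ψ q r l) = (if k = l then 1 else 0) ∧
      (∑ r ∈ I, ψ q k r * pd2 φ q r l) = (if k = l then 1 else 0))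
    -- `ψ` is the inverse of the Hessian on the `J = Iᶜ`-block
    (hinvJ : ∀ q ∈ U, ∀ k ∈ Iᶜ, ∀ l ∈ Iᶜ,
      (∑ r ∈ Iᶜ, pd2 φ q k r * ψ q r l) = (if k = l then 1 else 0) ∧
      (∑ r ∈ Iᶜ, ψ q k r * pd2 φ q r l) = (if k = l then 1 else 0))
    (m : Pt n) (hm : projPar I m ∈ U) :
    -- (a) `ξ` and each `Z_k` are `G`-orthogonal to every `Y_l`
    ((∀ l : Fin n, Gin n m (Pi.single (Sum.inl ()) 1 : Pt n) (Yfld I φ l m) = 0) ∧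
      ∀ k l : Fin n, Gin n m (Zfld I φ ψ k m) (Yfld I φ l m) = 0) ∧
    -- (b) `∇_{Y_k} Y_l = Σ_s φ_{lks} W_s = ½ Σ_{s,r} φ^{sr} φ_{lks} Y_r + Σ_s φ_{lks} Z_s`
    (∀ k l : Fin n,
      covDeriv n (Yfld I φ k) (Yfld I φ l) m = ∑ s, phid I φ k l s m • Wfld I s m ∧
      covDeriv n (Yfld I φ k) (Yfld I φ l) m =
        (∑ s, ∑ r, ((1 / 2 : ℝ) * ψ (projPar I m) s r * phid I φ k l s m) • Yfld I φ r m)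
          + ∑ s, phid I φ k l s m • Zfld I φ ψ s m) := by
  refine ⟨⟨?_, ?_⟩, ?_⟩
  · intro l
    rw [aux_Gin, aux_theta]
    simp
  · intro k l
    have e : Gin n m (Zfld I φ ψ k m) (Yfld I φ l m) = Gin n m (Wfld I k m) (Yfld I φ l m) -
      (1/2) * ∑ r, ψ (projPar I m) k r * Gin n m (Yfld I φ r m) (Yfld I φ l m) := by
      simp only [aux_Gin_dot, Zfld, sub_dotProduct, smul_dotProduct, sum_dotProduct, smul_eq_mul]
    rw [e, aux_GWY]
    simp only [aux_GYY I φ hφ]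
    rw [← Finset.sum_add_sum_compl I]
    by_cases hk : k ∈ I
    · rw [Finset.sum_eq_zero (s := Iᶜ) (fun r hr => by
        rw [hmix _ hm k r (Or.inl ⟨hk, by simpa using hr⟩), zero_mul])]
      by_cases hl : l ∈ I
      · have h := (hinvI _ hm k hk l hl).2
        rw [Finset.sum_congr rfl (g := fun r => 2 * (ψ (projPar I m) k r * pd2 φ (projPar I m) r l))
          (fun r hr => by simp only [hr, hl, if_true]; ring), ← Finset.mul_sum, h]
        simp only [hk, if_true]
        ring
      · have hkl : k ≠ l := fun h => hl (h ▸ hk)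
        rw [Finset.sum_eq_zero (fun r hr => by simp [hr, hl])]
        simp [hkl]
    · have hk' : k ∈ Iᶜ := by simpa using hk
      rw [Finset.sum_eq_zero (s := I) (fun r hr => by
        rw [hmix _ hm k r (Or.inr ⟨hk, hr⟩), zero_mul])]
      by_cases hl : l ∈ I
      · have hkl : k ≠ l := fun h => hk (h ▸ hl)
        rw [Finset.sum_eq_zero (fun r hr => by
          have hr' : r ∉ I := by simpa using hr
          simp [hr', hl])]
        simp [hkl]
      · have h := (hinvJ _ hm k hk' l (by simpa using hl)).2
        rw [Finset.sum_congr rfl (g := fun r => (-2) * (ψ (projPar I m) k r * pd2 φ (projPar I m) r l))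
          (fun r hr => by
            have hr' : r ∉ I := by simpa using hr
            simp only [hr', hl, if_false]; ring), ← Finset.mul_sum, h]
        simp only [hk, if_false]
        split_ifs <;> ring
  · intro k l
    refine ⟨aux_cov I φ hφ k l m, ?_⟩
    rw [aux_cov I φ hφ k l m, ← Finset.sum_add_distrib]
    refine Finset.sum_congr rfl fun s _ => ?_
    unfold Zfld
    rw [smul_sub, Finset.smul_sum, Finset.smul_sum]
    have : ∑ r, ((1 / 2 : ℝ) * ψ (projPar I m) s r * phid I φ k l s m) • Yfld I φ r m =
       ∑ r, phid I φ k l s m • (1 / 2 : ℝ) • ψ (projPar I m) s r • Yfld I φ r m := by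
      refine Finset.sum_congr rfl fun r _ => ?_
      rw [smul_smul, smul_smul]
      congr 1
      ring
    rw [this]
    abel
end

section
/- Let H_n = ℝ^n × ℝ^n × ℝ with coordinates (a, b, c) and Heisenberg multiplication (a,b,c)·(a′,b′,c′) = (a+a′, b+b′, c+c′+⟨a,b′⟩), and let χ : H_n → P be the diffeomorphism χ(a,b,c) = (x^0, p, x) = (−c, b, a). Set θ_H = χ*θ and G_H = χ*G, i.e. θ_H(h)(u) = θ(χ(h))(Dχ u) and G_H(h)(u,v) = ⟨Dχ u, G(χ(h)) Dχ v⟩. Then: (i) θ_H(a,b,c) = −dc + Σ_i b_i da^i; (ii) θ_H is right invariant: for all g, h ∈ H_n and u ∈ ℝ^{2n+1}, θ_H(h·g)(D_h R_g u) = θ_H(h)(u), where R_g(h) = h·g; (iii) G_H is right invariant: G_H(h·g)(D_h R_g u, D_h R_g v) = G_H(h)(u, v) for all g, h, u, v. Thus χ is an isomorphism of (P, θ, G) with the Heisenberg group endowed with a right invariant contact form and a right invariant metric of signature (n+1, n). -/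
/-- The Heisenberg group `H_n = ℝ^n × ℝ^n × ℝ`, coordinates `(a, b, c)`. -/
abbrev Heis (n : ℕ) : Type := (Fin n → ℝ) × (Fin n → ℝ) × ℝ

/-- The Heisenberg multiplication `(a,b,c)·(a',b',c') = (a+a', b+b', c+c'+⟨a,b'⟩)`. -/
noncomputable def hmul {n : ℕ} (g h : Heis n) : Heis n :=
  (g.1 + h.1, g.2.1 + h.2.1, g.2.2 + h.2.2 + ∑ i, g.1 i * h.2.1 i)

/-- The contact covector applied to a tangent vector: `θ(m)(v) = v^{x^0} + Σ p_l v^{x^l}`. -/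
noncomputable def thetaAp {n : ℕ} (m : Pt n) (v : Pt n) : ℝ :=
  v (Sum.inl ()) + ∑ l, m (Sum.inr (Sum.inl l)) * v (Sum.inr (Sum.inr l))

/-- The diffeomorphism `χ : H_n → P`, `χ(a,b,c) = (x^0, p, x) = (-c, b, a)`. -/
def chi {n : ℕ} (g : Heis n) : Pt n := fun idx =>
  match idx with
  | Sum.inl _ => -g.2.2
  | Sum.inr (Sum.inl i) => g.2.1 i
  | Sum.inr (Sum.inr i) => g.1 i

/-- The (constant) derivative `Dχ` of `χ`. -/
def Dchi {n : ℕ} (u : Heis n) : Pt n := chi u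

/-- The derivative at `h` of right translation `R_g : h ↦ h·g`:
`(u_a, u_b, u_c) ↦ (u_a, u_b, u_c + ⟨u_a, b_g⟩)`. -/
noncomputable def DR {n : ℕ} (g : Heis n) (u : Heis n) : Heis n :=
  (u.1, u.2.1, u.2.2 + ∑ i, u.1 i * g.2.1 i)

/-- The pulled-back contact form `θ_H = χ*θ`. -/
noncomputable def thetaH {n : ℕ} (h : Heis n) (u : Heis n) : ℝ :=
  thetaAp (chi h) (Dchi u)

/-- The pulled-back metric `G_H = χ*G`. -/
noncomputable def GH {n : ℕ} (h : Heis n) (u v : Heis n) : ℝ :=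
  ∑ a, ∑ b, Dchi u a * Gmat n (chi h) a b * Dchi v b

theorem thetaH_eq {n : ℕ} (h u : Heis n) :
    thetaH h u = -u.2.2 + ∑ i, h.2.1 i * u.1 i := rfl

theorem thetaH_inv {n : ℕ} (g h u : Heis n) :
    thetaH (hmul h g) (DR g u) = thetaH h u := by
  simp only [thetaH_eq, hmul, DR, Pi.add_apply, add_mul, Finset.sum_add_distrib]
  have : ∑ i, u.1 i * g.2.1 i = ∑ i, g.2.1 i * u.1 i :=
    Finset.sum_congr rfl fun i _ => mul_comm _ _
  rw [this]; ring

theorem GH_eq {n : ℕ} (h u v : Heis n) :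
    GH h u v = thetaH h u * thetaH h v
      + ((∑ i, u.2.1 i * v.1 i) + ∑ i, u.1 i * v.2.1 i) := by
  have e : (∑ i, ∑ j, u.1 i * (h.2.1 i * h.2.1 j) * v.1 j)
      = (∑ i, h.2.1 i * u.1 i) * ∑ j, h.2.1 j * v.1 j := by
    rw [Finset.sum_mul_sum]
    exact Finset.sum_congr rfl fun i _ => Finset.sum_congr rfl fun j _ => by ring
  have e1 : (∑ j, u.2.2 * h.2.1 j * v.1 j) = u.2.2 * ∑ j, h.2.1 j * v.1 j := by
    rw [Finset.mul_sum]
    exact Finset.sum_congr rfl fun i _ => by ring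
  have e2 : (∑ j, u.1 j * h.2.1 j * v.2.2) = (∑ j, h.2.1 j * u.1 j) * v.2.2 := by
    rw [Finset.sum_mul]
    exact Finset.sum_congr rfl fun i _ => by ring
  simp [thetaH_eq, GH, Gmat, Dchi, chi, Fintype.sum_sum_type, Finset.sum_add_distrib, e, e1, e2]
  ring

theorem heisenberg_isomorphism (n : ℕ) (hn : 1 ≤ n) :
    -- (i) `θ_H = -dc + Σ_i b_i da^i`
    (∀ (h : Heis n) (u : Heis n), thetaH h u = -u.2.2 + ∑ i, h.2.1 i * u.1 i) ∧
    -- (ii) `θ_H` is right invariant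
    (∀ (g h : Heis n) (u : Heis n), thetaH (hmul h g) (DR g u) = thetaH h u) ∧
    -- (iii) `G_H` is right invariant
    (∀ (g h : Heis n) (u v : Heis n),
      GH (hmul h g) (DR g u) (DR g v) = GH h u v) := by
  refine ⟨thetaH_eq, thetaH_inv, fun g h u v => ?_⟩
  rw [GH_eq, GH_eq, thetaH_inv, thetaH_inv]
  rfl
end
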